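/- arXiv:2406.11112 — 3 statements merged into one kernel-verified Lean document; each statement's English description precedes it below -/
import Mathlib

section
/- Let d ≥ 1 and let p, q : Fin d → ℝ be probability vectors (nonnegative entries summing to 1). Then the Shannon entropies satisfy |H(p) − H(q)| ≤ (∑_i |p_i − q_i|)·log d + 1/e, where H(p) := −∑_i p_i log p_i with natural logarithm and the convention 0·log 0 = 0. (Fannes' inequality, classical form.) -/
/-- The Shannon entropy `H(p) = -∑ᵢ pᵢ log pᵢ` (natural log, `0 log 0 = 0`). -/
noncomputable def shannonEntropy {d : ℕ} (p : Fin d → ℝ) : ℝ :=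
  -∑ i, p i * Real.log (p i)

/-- For `0 ≤ x ≤ y ≤ 1`, the function `x ↦ x log x` grows at most as fast as the identity. -/
lemma mul_log_sub_mul_log_le_sub {x y : ℝ} (hx : 0 ≤ x) (hxy : x ≤ y) (hy : y ≤ 1) :
    y * Real.log y - x * Real.log x ≤ y - x := by
  have hlog : Real.log y ≤ 0 := Real.log_nonpos (hx.trans hxy) hy
  have h₁ : (y - x) * Real.log y ≤ 0 :=
    mul_nonpos_of_nonneg_of_nonpos (sub_nonneg.2 hxy) hlog
  rcases hx.eq_or_lt with rfl | hx
  · simp only [zero_mul, sub_zero] at h₁ ⊢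
    linarith
  have hy₀ := hx.trans_le hxy
  have h₂ := Real.log_le_sub_one_of_pos (div_pos hy₀ hx)
  rw [Real.log_div hy₀.ne' hx.ne'] at h₂
  have h₃ := mul_le_mul_of_nonneg_left h₂ hx.le
  have h₄ : x * (y / x - 1) = y - x := by field_simp
  linarith

/-- Subadditivity of `x ↦ -x log x` combined with its tangent line at `c`. -/
lemma mul_log_sub_mul_log_le_tangent {x y c : ℝ} (hx : 0 ≤ x) (hxy : x < y) (hc : 0 < c) :
    x * Real.log x - y * Real.log y ≤ -(y - x) * Real.log c + c - (y - x) := by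
  have hr : 0 < y - x := sub_pos.2 hxy
  have h₁ : x * Real.log x ≤ x * Real.log y := by
    rcases hx.eq_or_lt with rfl | hx
    · simp
    · exact mul_le_mul_of_nonneg_left (Real.log_le_log hx hxy.le) hx.le
  have h₂ : (y - x) * Real.log (y - x) ≤ (y - x) * Real.log y :=
    mul_le_mul_of_nonneg_left (Real.log_le_log hr (by linarith)) hr.le
  have h₃ := Real.log_le_sub_one_of_pos (div_pos hc hr)
  rw [Real.log_div hc.ne' hr.ne'] at h₃
  have h₄ := mul_le_mul_of_nonneg_left h₃ hr.le
  have h₅ : (y - x) * (c / (y - x) - 1) = c - (y - x) := by field_simp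
  linarith

/-- The one-sided form of Fannes' inequality. -/
lemma shannonEntropy_sub_le {d : ℕ} (hd : 1 ≤ d) (p q : Fin d → ℝ)
    (hp : ∀ i, 0 ≤ p i) (hp1 : ∑ i, p i = 1) (hq : ∀ i, 0 ≤ q i) (hq1 : ∑ i, q i = 1) :
    shannonEntropy p - shannonEntropy q ≤
      (∑ i, |p i - q i|) * Real.log d + 1 / Real.exp 1 := by
  have hd₀ : (0 : ℝ) < d := by exact_mod_cast hd
  set c : ℝ := 1 / (d : ℝ) ^ 2 with hc
  have hc₀ : 0 < c := by positivity
  have hlog : Real.log c = -(2 * Real.log d) := by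
    rw [hc, one_div, Real.log_inv, Real.log_pow]
    norm_num
  have hle : ∀ i, q i * Real.log (q i) - p i * Real.log (p i) ≤
      (|p i - q i| + (p i - q i)) * Real.log d - (p i - q i) + if q i < p i then c else 0 := by
    intro i
    split_ifs with h
    · have := mul_log_sub_mul_log_le_tangent (hq i) h hc₀
      rw [hlog] at this
      rw [abs_of_pos (sub_pos.2 h)]
      linarith
    · have hq_le : q i ≤ 1 :=
        hq1 ▸ Finset.single_le_sum (fun j _ => hq j) (Finset.mem_univ i)
      have := mul_log_sub_mul_log_le_sub (hp i) (not_lt.1 h) hq_le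
      rw [abs_of_nonpos (by linarith)]
      linarith
  have hsum := Finset.sum_le_sum fun i (_ : i ∈ Finset.univ) => hle i
  simp only [Finset.sum_add_distrib, Finset.sum_sub_distrib, ← Finset.sum_mul, hp1, hq1,
    ← Finset.sum_filter, Finset.sum_const, nsmul_eq_mul] at hsum
  have hcard : (Finset.univ.filter fun i => q i < p i).card < d := by
    obtain ⟨i, -, hi⟩ := Finset.exists_le_of_sum_le (s := Finset.univ) (f := p) (g := q)
      ⟨⟨0, hd⟩, Finset.mem_univ _⟩ (hp1.trans hq1.symm).le
    have hne : (Finset.univ.filter fun i => q i < p i) ⊂ Finset.univ :=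
      Finset.filter_ssubset.2 ⟨i, Finset.mem_univ i, not_lt.2 hi⟩
    simpa using Finset.card_lt_card hne
  have hcard' : ((Finset.univ.filter fun i => q i < p i).card : ℝ) ≤ d - 1 := by
    rw [le_sub_iff_add_le]
    exact_mod_cast hcard
  have hquarter : ((Finset.univ.filter fun i => q i < p i).card : ℝ) * c ≤ 1 / 4 := by
    rw [hc, mul_one_div, div_le_div_iff₀ (by positivity) (by norm_num)]
    nlinarith [sq_nonneg ((d : ℝ) - 2)]
  have hexp : (1 : ℝ) / 4 ≤ 1 / Real.exp 1 :=
    one_div_le_one_div_of_le (Real.exp_pos 1) (by linarith [Real.exp_one_lt_d9])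
  unfold shannonEntropy
  linarith

/-- Fannes' inequality, classical form: for probability vectors `p, q` on a `d`-point space,
`|H(p) - H(q)| ≤ (∑ᵢ |pᵢ - qᵢ|) log d + 1/e`. -/
theorem fannes_inequality_classical (d : ℕ) (hd : 1 ≤ d) (p q : Fin d → ℝ)
    (hp : ∀ i, 0 ≤ p i) (hp1 : ∑ i, p i = 1)
    (hq : ∀ i, 0 ≤ q i) (hq1 : ∑ i, q i = 1) :
    |shannonEntropy p - shannonEntropy q| ≤
      (∑ i, |p i - q i|) * Real.log d + 1 / Real.exp 1 := by
  refine abs_sub_le_iff.2 ⟨shannonEntropy_sub_le hd p q hp hp1 hq hq1, ?_⟩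
  simpa only [abs_sub_comm] using shannonEntropy_sub_le hd q p hq hq1 hp hp1
end

section
/- Let d ≥ 1 and let ρ, σ be density matrices on ℂ^d. Let T := ∑_i |μ_i|, where (μ_i) are the real eigenvalues of the Hermitian matrix ρ − σ (so T is the trace norm ‖ρ − σ‖₁). Then the von Neumann entropies satisfy |S(ρ) − S(σ)| ≤ T·log d + 1/e. (Fannes' inequality.) -/
open scoped ComplexOrder

/-- The von Neumann entropy `S(ρ) = -∑ᵢ λᵢ log λᵢ` of a Hermitian matrix `ρ`, where `λᵢ` are its
real eigenvalues (and `0` for non-Hermitian matrices, by convention). -/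
noncomputable def vnEntropy {ι : Type*} [Fintype ι] [DecidableEq ι] (ρ : Matrix ι ι ℂ) : ℝ :=
  if h : ρ.IsHermitian then -∑ i, h.eigenvalues i * Real.log (h.eigenvalues i) else 0

namespace Fannes

open Module

variable {E : Type*} [NormedAddCommGroup E] [InnerProductSpace ℂ E]
variable {ι κ : Type*} [Fintype ι] [Fintype κ]

/-- The quadratic form of the operator that is diagonal in the orthonormal basis `e`, with
eigenvalues `a`. -/
noncomputable def diagForm (e : OrthonormalBasis ι ℂ E) (a : ι → ℝ) (x : E) : ℝ :=
  ∑ k, a k * ‖inner ℂ (e k) x‖ ^ 2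

lemma diagForm_nonneg (e : OrthonormalBasis ι ℂ E) {a : ι → ℝ} (ha : ∀ k, 0 ≤ a k) (x : E) :
    0 ≤ diagForm e a x :=
  Finset.sum_nonneg fun k _ => mul_nonneg (ha k) (sq_nonneg _)

lemma mul_sq_le_diagForm (e : OrthonormalBasis ι ℂ E) {a : ι → ℝ} (ha : ∀ k, 0 ≤ a k) (x : E)
    (k : ι) : a k * ‖inner ℂ (e k) x‖ ^ 2 ≤ diagForm e a x :=
  Finset.single_le_sum (f := fun k => a k * ‖inner ℂ (e k) x‖ ^ 2)
    (fun k _ => mul_nonneg (ha k) (sq_nonneg _)) (Finset.mem_univ k)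

lemma diagForm_self (e : OrthonormalBasis ι ℂ E) (a : ι → ℝ) (k : ι) :
    diagForm e a (e k) = a k := by
  classical
  unfold diagForm
  rw [Finset.sum_eq_single k]
  · simp
  · intro j _ hj
    simp [e.orthonormal.inner_eq_zero hj]
  · simp

lemma sum_overlap_left (e : OrthonormalBasis ι ℂ E) (u : OrthonormalBasis κ ℂ E) (k : ι) :
    ∑ j, ‖inner ℂ (e k) (u j)‖ ^ 2 = 1 := by
  rw [u.sum_sq_norm_inner_left]
  simp

lemma sum_overlap_right (e : OrthonormalBasis ι ℂ E) (u : OrthonormalBasis κ ℂ E) (j : κ) :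
    ∑ k, ‖inner ℂ (e k) (u j)‖ ^ 2 = 1 := by
  rw [e.sum_sq_norm_inner_right]
  simp

lemma sum_diagForm (e : OrthonormalBasis ι ℂ E) (a : ι → ℝ) (u : OrthonormalBasis κ ℂ E) :
    ∑ j, diagForm e a (u j) = ∑ k, a k := by
  unfold diagForm
  rw [Finset.sum_comm]
  simp [← Finset.mul_sum, sum_overlap_left]

/-- A sum of two diagonalizable forms is diagonalizable. -/
lemma exists_diagForm_eq_add {n : ℕ} (e f : OrthonormalBasis (Fin n) ℂ E) (a b : Fin n → ℝ) :
    ∃ (u : OrthonormalBasis (Fin n) ℂ E) (w : Fin n → ℝ),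
      ∀ x, diagForm u w x = diagForm e a x + diagForm f b x := by
  have : FiniteDimensional ℂ E := e.toBasis.finiteDimensional_of_finite
  have hn : finrank ℂ E = n := by simpa using finrank_eq_card_basis e.toBasis
  let R (e : OrthonormalBasis (Fin n) ℂ E) (a : Fin n → ℝ) : E →ₗ[ℂ] E :=
    ∑ k, (a k : ℂ) • (InnerProductSpace.rankOne ℂ (e k) (e k)).toLinearMap
  have hR (e : OrthonormalBasis (Fin n) ℂ E) (a : Fin n → ℝ) (x y : E) :
      inner ℂ x (R e a y) = ∑ k, (a k : ℂ) * (inner ℂ (e k) y * inner ℂ x (e k)) := by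
    simp [R, LinearMap.sum_apply]
  have hsym (e : OrthonormalBasis (Fin n) ℂ E) (a : Fin n → ℝ) : (R e a).IsSymmetric := by
    intro x y
    rw [← inner_conj_symm, hR, hR, map_sum]
    refine Finset.sum_congr rfl fun k _ => ?_
    simp only [map_mul, inner_conj_symm, Complex.conj_ofReal]
    ring
  have hq (e : OrthonormalBasis (Fin n) ℂ E) (a : Fin n → ℝ) (x : E) :
      inner ℂ x (R e a x) = (diagForm e a x : ℂ) := by
    rw [hR]
    unfold diagForm
    push_cast
    refine Finset.sum_congr rfl fun k _ => ?_
    rw [← inner_conj_symm x (e k), Complex.mul_conj, Complex.normSq_eq_norm_sq]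
    push_cast
    rfl
  have hT := (hsym e a).add (hsym f b)
  refine ⟨hT.eigenvectorBasis hn, hT.eigenvalues hn, fun x => ?_⟩
  have key : R (hT.eigenvectorBasis hn) (hT.eigenvalues hn) = R e a + R f b := by
    refine (hT.eigenvectorBasis hn).toBasis.ext fun j => ?_
    rw [OrthonormalBasis.coe_toBasis, hT.apply_eigenvectorBasis hn j]
    simp only [R, LinearMap.sum_apply, LinearMap.smul_apply, ContinuousLinearMap.coe_coe,
      InnerProductSpace.rankOne_apply]
    rw [Finset.sum_eq_single j]
    · simp
    · intro k _ hk
      simp [(hT.eigenvectorBasis hn).orthonormal.inner_eq_zero hk]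
    · simp
  have h := hq (hT.eigenvectorBasis hn) (hT.eigenvalues hn) x
  rw [key, LinearMap.add_apply, inner_add_right, hq, hq] at h
  exact_mod_cast h.symm

section Comparison

variable {e : OrthonormalBasis ι ℂ E} {u : OrthonormalBasis κ ℂ E} {a : ι → ℝ} {w : κ → ℝ}

lemma mul_overlap_eq_zero (ha : ∀ k, 0 ≤ a k) (h : ∀ x, diagForm e a x ≤ diagForm u w x)
    (k : ι) {j : κ} (hj : w j = 0) : a k * ‖inner ℂ (e k) (u j)‖ ^ 2 = 0 := by
  have h1 := mul_sq_le_diagForm e ha (u j) k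
  have h2 := h (u j)
  rw [diagForm_self, hj] at h2
  exact le_antisymm (h1.trans h2) (mul_nonneg (ha k) (sq_nonneg _))

lemma mul_sum_overlap_div_le_one (ha : ∀ k, 0 ≤ a k)
    (h : ∀ x, diagForm e a x ≤ diagForm u w x) (k : ι) :
    a k * ∑ j, ‖inner ℂ (e k) (u j)‖ ^ 2 / w j ≤ 1 := by
  classical
  set s := ∑ j, ‖inner ℂ (e k) (u j)‖ ^ 2 / w j with hs
  have hw (j : κ) : 0 ≤ w j := by
    have := (diagForm_nonneg e ha (u j)).trans (h (u j))
    rwa [diagForm_self] at this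
  have hs0 : 0 ≤ s := Finset.sum_nonneg fun j _ => div_nonneg (sq_nonneg _) (hw j)
  let x : E := ∑ j, (inner ℂ (u j) (e k) / (w j : ℂ)) • u j
  have hux (j : κ) : inner ℂ (u j) x = inner ℂ (u j) (e k) / (w j : ℂ) :=
    u.orthonormal.inner_right_fintype _ j
  have hq : diagForm u w x = s := by
    refine Finset.sum_congr rfl fun j _ => ?_
    rw [hux, norm_div, Complex.norm_real, Real.norm_of_nonneg (hw j), norm_inner_symm]
    by_cases hj : w j = 0
    · simp [hj]
    · field_simp
  have hex : inner ℂ (e k) x = (s : ℂ) := by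
    simp only [x, inner_sum, inner_smul_right, hs]
    push_cast
    refine Finset.sum_congr rfl fun j _ => ?_
    rw [div_mul_eq_mul_div, ← inner_conj_symm (u j) (e k), mul_comm, Complex.mul_conj,
      Complex.normSq_eq_norm_sq]
    push_cast
    rfl
  have h1 := (mul_sq_le_diagForm e ha x k).trans (h x)
  rw [hq, hex, Complex.norm_real, Real.norm_of_nonneg hs0] at h1
  rcases hs0.eq_or_lt with h0 | h0
  · rw [← h0]; simp
  · by_contra! hlt
    nlinarith

/-- Operator monotonicity of the logarithm, in the form `-tr (A log W) ≤ -tr (A log A)` for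
`0 ≤ A ≤ W`. -/
lemma neg_sum_diagForm_mul_log_le (ha : ∀ k, 0 ≤ a k)
    (h : ∀ x, diagForm e a x ≤ diagForm u w x) :
    -∑ j, diagForm e a (u j) * Real.log (w j) ≤ -∑ k, a k * Real.log (a k) := by
  have hw (j : κ) : 0 ≤ w j := by
    have := (diagForm_nonneg e ha (u j)).trans (h (u j))
    rwa [diagForm_self] at this
  rw [neg_le_neg_iff]
  simp only [diagForm, Finset.sum_mul]
  rw [Finset.sum_comm]
  refine Finset.sum_le_sum fun k _ => ?_
  have hterm (j : κ) : a k * ‖inner ℂ (e k) (u j)‖ ^ 2 -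
      a k * (a k * (‖inner ℂ (e k) (u j)‖ ^ 2 / w j)) ≤
      a k * ‖inner ℂ (e k) (u j)‖ ^ 2 * Real.log (w j) -
        a k * Real.log (a k) * ‖inner ℂ (e k) (u j)‖ ^ 2 := by
    rcases (ha k).eq_or_lt with hk | hk
    · simp [← hk]
    rcases (hw j).eq_or_lt with hj | hj
    · have h0 := mul_overlap_eq_zero ha h k hj.symm
      have h1 : ‖inner ℂ (e k) (u j)‖ ^ 2 = 0 := (mul_eq_zero.mp h0).resolve_left hk.ne'
      simp [h1]
    · have hl := Real.log_le_sub_one_of_pos (div_pos hk hj)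
      rw [Real.log_div hk.ne' hj.ne'] at hl
      have := mul_le_mul_of_nonneg_left hl (mul_nonneg hk.le (sq_nonneg ‖inner ℂ (e k) (u j)‖))
      have h2 : a k * (a k * (‖inner ℂ (e k) (u j)‖ ^ 2 / w j)) =
        a k * ‖inner ℂ (e k) (u j)‖ ^ 2 * (a k / w j) := by ring
      rw [h2]
      linarith
  have hsum := Finset.sum_le_sum fun j (_ : j ∈ Finset.univ) => hterm j
  rw [Finset.sum_sub_distrib, Finset.sum_sub_distrib, ← Finset.mul_sum, ← Finset.mul_sum,
    ← Finset.mul_sum, ← Finset.mul_sum, sum_overlap_left] at hsum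
  have := mul_le_mul_of_nonneg_left (mul_sum_overlap_div_le_one ha h k) (ha k)
  linarith

/-- Klein's inequality, in the form `-tr (A log A) ≤ -tr (A log (W / tr W))` for `0 ≤ A ≤ W` with
`tr A = 1`. -/
lemma neg_sum_mul_log_le (ha : ∀ k, 0 ≤ a k) (h : ∀ x, diagForm e a x ≤ diagForm u w x)
    (ha1 : ∑ k, a k = 1) {W : ℝ} (hW : 0 < W) (hwW : ∑ j, w j = W) :
    -∑ k, a k * Real.log (a k) ≤
      -∑ j, diagForm e a (u j) * Real.log (w j) + Real.log W := by
  have hw (j : κ) : 0 ≤ w j := by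
    have := (diagForm_nonneg e ha (u j)).trans (h (u j))
    rwa [diagForm_self] at this
  have hterm (k : ι) (j : κ) : a k * ‖inner ℂ (e k) (u j)‖ ^ 2 -
      w j / W * ‖inner ℂ (e k) (u j)‖ ^ 2 ≤
      a k * Real.log (a k) * ‖inner ℂ (e k) (u j)‖ ^ 2 -
        a k * ‖inner ℂ (e k) (u j)‖ ^ 2 * Real.log (w j) +
        a k * Real.log W * ‖inner ℂ (e k) (u j)‖ ^ 2 := by
    have hp := sq_nonneg ‖inner ℂ (e k) (u j)‖
    rcases (ha k).eq_or_lt with hk | hk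
    · simp only [← hk, zero_mul]
      have := mul_nonneg (div_nonneg (hw j) hW.le) hp
      linarith
    rcases (hw j).eq_or_lt with hj | hj
    · have h0 := mul_overlap_eq_zero ha h k hj.symm
      have h1 : ‖inner ℂ (e k) (u j)‖ ^ 2 = 0 := (mul_eq_zero.mp h0).resolve_left hk.ne'
      simp [h1]
    · have hl := Real.log_le_sub_one_of_pos (div_pos hj (mul_pos hW hk))
      rw [Real.log_div hj.ne' (mul_pos hW hk).ne', Real.log_mul hW.ne' hk.ne'] at hl
      have := mul_le_mul_of_nonneg_left hl (mul_nonneg hk.le hp)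
      have h2 : w j / W * ‖inner ℂ (e k) (u j)‖ ^ 2 =
        a k * ‖inner ℂ (e k) (u j)‖ ^ 2 * (w j / (W * a k)) := by field_simp
      rw [h2]
      linarith
  have hsum := Finset.sum_le_sum fun k (_ : k ∈ Finset.univ) =>
    Finset.sum_le_sum fun j (_ : j ∈ Finset.univ) => hterm k j
  simp only [Finset.sum_sub_distrib, Finset.sum_add_distrib] at hsum
  have e1 : ∑ k, ∑ j, a k * ‖inner ℂ (e k) (u j)‖ ^ 2 = 1 := by
    simp [← Finset.mul_sum, sum_overlap_left, ha1]
  have e2 : ∑ k, ∑ j, w j / W * ‖inner ℂ (e k) (u j)‖ ^ 2 = 1 := by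
    rw [Finset.sum_comm]
    simp only [← Finset.mul_sum, sum_overlap_right, mul_one]
    rw [← Finset.sum_div, hwW, div_self hW.ne']
  have e3 : ∑ k, ∑ j, a k * Real.log (a k) * ‖inner ℂ (e k) (u j)‖ ^ 2 =
      ∑ k, a k * Real.log (a k) := by
    simp [← Finset.mul_sum, sum_overlap_left]
  have e4 : ∑ k, ∑ j, a k * Real.log W * ‖inner ℂ (e k) (u j)‖ ^ 2 = Real.log W := by
    simp [← Finset.mul_sum, sum_overlap_left, ← Finset.sum_mul, ha1]
  have e5 : ∑ k, ∑ j, a k * ‖inner ℂ (e k) (u j)‖ ^ 2 * Real.log (w j) =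
      ∑ j, diagForm e a (u j) * Real.log (w j) := by
    rw [Finset.sum_comm]
    simp [diagForm, Finset.sum_mul]
  rw [e1, e2, e3, e4, e5] at hsum
  linarith

end Comparison

/-- Entropy bound for a nonnegative vector with a vanishing coordinate. -/
lemma neg_sum_mul_log_le_of_eq_zero {q : ι → ℝ} (hq : ∀ k, 0 ≤ q k) {t : ℝ} (ht : 0 < t)
    (hsum : ∑ k, q k = t) {k₀ : ι} (hk₀ : q k₀ = 0) :
    -∑ k, q k * Real.log (q k) ≤
      t * Real.log ((Fintype.card ι : ℝ) - 1) - t * Real.log t := by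
  classical
  have hs : ∑ k ∈ Finset.univ.erase k₀, q k = t := by
    rw [← hsum]; exact Finset.sum_erase _ hk₀
  have hs' : ∑ k ∈ Finset.univ.erase k₀, q k * Real.log (q k) = ∑ k, q k * Real.log (q k) :=
    Finset.sum_erase _ (by simp [hk₀])
  have hcard : ((Finset.univ.erase k₀).card : ℝ) = (Fintype.card ι : ℝ) - 1 := by
    rw [Finset.card_erase_of_mem (Finset.mem_univ _), Finset.card_univ,
      Nat.cast_pred (Fintype.card_pos_iff.mpr ⟨k₀⟩)]
  have hne : (Finset.univ.erase k₀).Nonempty := by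
    rw [Finset.nonempty_iff_ne_empty]
    intro h
    rw [h, Finset.sum_empty] at hs
    exact ht.ne hs
  rw [← hs', ← hcard]
  set m : ℝ := ((Finset.univ.erase k₀).card : ℝ) with hm
  have hm0 : 0 < m := by rw [hm]; exact_mod_cast hne.card_pos
  have hterm (k : ι) : q k - t / m ≤
      q k * Real.log (q k) + q k * (Real.log m - Real.log t) := by
    rcases (hq k).eq_or_lt with hk | hk
    · simp only [← hk]
      have := div_pos ht hm0
      linarith
    · have hl := Real.log_le_sub_one_of_pos (div_pos ht (mul_pos hm0 hk))
      rw [Real.log_div ht.ne' (mul_pos hm0 hk).ne', Real.log_mul hm0.ne' hk.ne'] at hl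
      have := mul_le_mul_of_nonneg_left hl hk.le
      have h2 : t / m = q k * (t / (m * q k)) := by field_simp
      rw [h2]
      linarith
  have := Finset.sum_le_sum fun k (_ : k ∈ Finset.univ.erase k₀) => hterm k
  rw [Finset.sum_sub_distrib, Finset.sum_add_distrib, ← Finset.sum_mul, hs, Finset.sum_const,
    nsmul_eq_mul, ← hm, mul_div_cancel₀ _ hm0.ne'] at this
  linarith

lemma neg_mul_log_le_inv_exp {t : ℝ} (ht : 0 < t) : -(t * Real.log t) ≤ 1 / Real.exp 1 := by
  have he := Real.exp_pos 1
  have hl := Real.log_le_sub_one_of_pos (div_pos one_pos (mul_pos ht he))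
  rw [Real.log_div one_ne_zero (mul_pos ht he).ne', Real.log_mul ht.ne' he.ne', Real.log_one,
    Real.log_exp] at hl
  have := mul_le_mul_of_nonneg_left hl ht.le
  have h2 : 1 / Real.exp 1 = t * (1 / (t * Real.exp 1)) := by field_simp
  rw [h2]
  linarith

lemma one_add_mul_log_le {t : ℝ} (ht : 0 ≤ t) (ht1 : t ≤ 1) :
    (1 + t) * Real.log (1 + t) ≤ t * (2 * Real.log 2) := by
  have h := Real.convexOn_mul_log.2 (x := 1) (y := 2) (by simp) (by simp)
    (sub_nonneg.mpr ht1) ht (by ring)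
  simp only [smul_eq_mul, Real.log_one] at h
  have h1 : (1 - t) * 1 + t * 2 = 1 + t := by ring
  rw [h1] at h
  linarith

lemma scalar_bound {d : ℕ} (hd : 2 ≤ d) {t : ℝ} (ht : 0 < t) (ht1 : t ≤ 1) :
    t * Real.log ((d : ℝ) - 1) - t * Real.log t + (1 + t) * Real.log (1 + t) ≤
      2 * t * Real.log d + 1 / Real.exp 1 := by
  have hd' : (2 : ℝ) ≤ d := by exact_mod_cast hd
  have h1 := neg_mul_log_le_inv_exp ht
  have h2 := one_add_mul_log_le ht.le ht1
  have h3 : Real.log ((d : ℝ) - 1) + 2 * Real.log 2 ≤ 2 * Real.log d := by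
    have hpos : (0 : ℝ) < d - 1 := by linarith
    have : Real.log (((d : ℝ) - 1) * 2 ^ 2) ≤ Real.log ((d : ℝ) ^ 2) :=
      Real.log_le_log (by positivity) (by nlinarith [sq_nonneg ((d : ℝ) - 2)])
    rwa [Real.log_mul hpos.ne' (by norm_num), Real.log_pow, Real.log_pow, Nat.cast_ofNat] at this
  have h4 := mul_le_mul_of_nonneg_left h3 ht.le
  linarith

/-- One direction of Fannes' inequality, for operators given in diagonal form. -/
lemma entropy_sub_le {d : ℕ} (e f g : OrthonormalBasis (Fin d) ℂ E) {r s m : Fin d → ℝ}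
    (hr : ∀ k, 0 ≤ r k) (hs : ∀ k, 0 ≤ s k) (hr1 : ∑ k, r k = 1) (hs1 : ∑ k, s k = 1)
    (hm : ∀ x, diagForm e r x - diagForm f s x = diagForm g m x) :
    -∑ k, s k * Real.log (s k) - -∑ k, r k * Real.log (r k) ≤
      (∑ k, |m k|) * Real.log d + 1 / Real.exp 1 := by
  have hmsum : ∑ k, m k = 0 := by
    rw [← sum_diagForm g m g, ← Finset.sum_congr rfl fun j _ => hm (g j),
      Finset.sum_sub_distrib, sum_diagForm, sum_diagForm, hr1, hs1, sub_self]
  set q : Fin d → ℝ := fun k => (m k)⁻ with hqdef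
  set p : Fin d → ℝ := fun k => (m k)⁺ with hpdef
  have hq (k) : 0 ≤ q k := negPart_nonneg _
  have hp (k) : 0 ≤ p k := posPart_nonneg _
  have hpq (k) : p k - q k = m k := posPart_sub_negPart _
  have habs (k) : p k + q k = |m k| := posPart_add_negPart _
  set t := ∑ k, q k with ht
  have hpt : ∑ k, p k = t := by
    have : ∑ k, p k - ∑ k, q k = 0 := by
      rw [← Finset.sum_sub_distrib, ← hmsum]; exact Finset.sum_congr rfl fun k _ => hpq k
    linarith
  have hT : ∑ k, |m k| = 2 * t := by
    rw [← Finset.sum_congr rfl fun k _ => habs k, Finset.sum_add_distrib, hpt]; ring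
  have ht0 : 0 ≤ t := Finset.sum_nonneg fun k _ => hq k
  have ht1 : t ≤ 1 := by
    rw [← hs1, ← sum_diagForm f s g]
    refine Finset.sum_le_sum fun k _ => ?_
    have h1 := hm (g k)
    rw [diagForm_self] at h1
    have h2 := diagForm_nonneg e hr (g k)
    exact sup_le (by linarith) (diagForm_nonneg f hs (g k))
  obtain ⟨u, w, hω⟩ := exists_diagForm_eq_add e g r q
  have hω' (x : E) : diagForm u w x = diagForm f s x + diagForm g p x := by
    have h1 : diagForm g m x = diagForm g p x - diagForm g q x := by
      simp only [diagForm, ← Finset.sum_sub_distrib, ← hpq, sub_mul]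
    linarith [hω x, hm x]
  have hrw (x) : diagForm e r x ≤ diagForm u w x := by
    linarith [hω x, diagForm_nonneg g hq x]
  have hqw (x) : diagForm g q x ≤ diagForm u w x := by
    linarith [hω x, diagForm_nonneg e hr x]
  have hsw (x) : diagForm f s x ≤ diagForm u w x := by
    linarith [hω' x, diagForm_nonneg g hp x]
  have hw (j) : 0 ≤ w j := by
    rw [← diagForm_self u w j]; exact (diagForm_nonneg e hr _).trans (hrw _)
  have hwsum : ∑ j, w j = 1 + t := by
    rw [← sum_diagForm u w u, Finset.sum_congr rfl fun j _ => hω (u j),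
      Finset.sum_add_distrib, sum_diagForm, sum_diagForm, hr1]
  have hwle (j) : Real.log (w j) ≤ Real.log (1 + t) := by
    rcases (hw j).eq_or_lt with hj | hj
    · rw [← hj, Real.log_zero]; exact Real.log_nonneg (by linarith)
    · refine Real.log_le_log hj ?_
      rw [← hwsum]
      exact Finset.single_le_sum (fun k _ => hw k) (Finset.mem_univ j)
  have upper : -∑ j, w j * Real.log (w j) ≤
      -∑ k, r k * Real.log (r k) + -∑ k, q k * Real.log (q k) := by
    have h1 := neg_sum_diagForm_mul_log_le hr hrw
    have h2 := neg_sum_diagForm_mul_log_le hq hqw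
    have h3 : ∑ j, w j * Real.log (w j) = ∑ j, diagForm e r (u j) * Real.log (w j) +
        ∑ j, diagForm g q (u j) * Real.log (w j) := by
      rw [← Finset.sum_add_distrib]
      refine Finset.sum_congr rfl fun j _ => ?_
      rw [← add_mul, ← hω, diagForm_self]
    linarith
  have lower : -∑ k, s k * Real.log (s k) ≤
      -∑ j, w j * Real.log (w j) + (1 + t) * Real.log (1 + t) := by
    have h1 := neg_sum_mul_log_le hs hsw hs1 (by linarith : 0 < 1 + t) hwsum
    have h2 : ∑ j, diagForm g p (u j) * Real.log (w j) ≤ t * Real.log (1 + t) := by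
      rw [← hpt, ← sum_diagForm g p u, Finset.sum_mul, sum_diagForm, hpt]
      exact Finset.sum_le_sum fun j _ =>
        mul_le_mul_of_nonneg_left (hwle j) (diagForm_nonneg g hp _)
    have h3 : ∑ j, w j * Real.log (w j) = ∑ j, diagForm f s (u j) * Real.log (w j) +
        ∑ j, diagForm g p (u j) * Real.log (w j) := by
      rw [← Finset.sum_add_distrib]
      refine Finset.sum_congr rfl fun j _ => ?_
      rw [← add_mul, ← hω', diagForm_self]
    linarith
  rw [hT]
  rcases ht0.eq_or_lt with h0 | h0
  · have hq0 (k) : q k = 0 :=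
      (Finset.sum_eq_zero_iff_of_nonneg fun k _ => hq k).mp (ht.symm.trans h0.symm) k
        (Finset.mem_univ k)
    simp only [hq0, zero_mul, Finset.sum_const_zero] at upper
    rw [← h0] at lower ⊢
    have := (div_pos one_pos (Real.exp_pos 1)).le
    simp only [add_zero, Real.log_one, mul_zero, zero_mul] at lower ⊢
    linarith
  · obtain ⟨i, -, hi⟩ := Finset.exists_ne_zero_of_sum_ne_zero (hpt.trans_ne h0.ne')
    obtain ⟨j, -, hj⟩ := Finset.exists_ne_zero_of_sum_ne_zero (ht.symm.trans_ne h0.ne')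
    have hqi : q i = 0 := by
      have : 0 < m i := posPart_pos_iff.mp ((hp i).lt_of_ne' hi)
      exact negPart_eq_zero.mpr this.le
    have hij : i ≠ j := fun h => hj (h ▸ hqi)
    have hd : 2 ≤ d := by
      have := i.isLt
      have := j.isLt
      have := Fin.val_ne_of_ne hij
      omega
    have h1 := neg_sum_mul_log_le_of_eq_zero hq h0 ht.symm hqi
    rw [Fintype.card_fin] at h1
    have h2 := scalar_bound hd h0 ht1
    linarith

lemma diagForm_eq_re_inner_toEuclideanLin {n : Type*} [Fintype n] [DecidableEq n]
    {A : Matrix n n ℂ} (hA : A.IsHermitian) (x : EuclideanSpace ℂ n) :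
    diagForm hA.eigenvectorBasis hA.eigenvalues x =
      (inner ℂ x (Matrix.toEuclideanLin A x)).re := by
  have happ (k : n) : inner ℂ (hA.eigenvectorBasis k) (Matrix.toEuclideanLin A x) =
      (hA.eigenvalues k : ℂ) * inner ℂ (hA.eigenvectorBasis k) x := by
    rw [← Matrix.isSymmetric_toEuclideanLin_iff.mpr hA]
    have : Matrix.toEuclideanLin A (hA.eigenvectorBasis k) =
        (hA.eigenvalues k : ℂ) • hA.eigenvectorBasis k := by
      ext i
      simpa [Matrix.toLpLin_apply] using congrFun (hA.mulVec_eigenvectorBasis k) i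
    rw [this, inner_smul_left, Complex.conj_ofReal]
  rw [← hA.eigenvectorBasis.sum_inner_mul_inner, Complex.re_sum]
  refine Finset.sum_congr rfl fun k _ => ?_
  rw [happ, mul_left_comm, Complex.re_ofReal_mul, ← inner_conj_symm x, mul_comm (starRingEnd ℂ _),
    Complex.mul_conj, Complex.normSq_eq_norm_sq, Complex.ofReal_re]

lemma diagForm_neg (e : OrthonormalBasis ι ℂ E) (a : ι → ℝ) (x : E) :
    diagForm e (-a) x = -diagForm e a x := by
  simp [diagForm]

lemma sum_eigenvalues_eq_one {n : Type*} [Fintype n] [DecidableEq n] {A : Matrix n n ℂ}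
    (hA : A.IsHermitian) (htr : A.trace = 1) : ∑ k, hA.eigenvalues k = 1 := by
  have := hA.trace_eq_sum_eigenvalues
  rw [htr] at this
  apply Complex.ofReal_injective
  simpa using this.symm

end Fannes

/-- Fannes' inequality: for density matrices `ρ, σ` on `ℂ^d`, with `T = ‖ρ - σ‖₁` the trace norm
(the sum of absolute values of the eigenvalues of the Hermitian matrix `ρ - σ`),
`|S(ρ) - S(σ)| ≤ T log d + 1/e`. -/
theorem fannes_inequality (d : ℕ) (hd : 1 ≤ d) (ρ σ : Matrix (Fin d) (Fin d) ℂ)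
    (hρ : ρ.PosSemidef) (hρtr : ρ.trace = 1)
    (hσ : σ.PosSemidef) (hσtr : σ.trace = 1) :
    |vnEntropy ρ - vnEntropy σ| ≤
      (∑ i, |(hρ.1.sub hσ.1).eigenvalues i|) * Real.log d + 1 / Real.exp 1 := by
  have hdiff (x : EuclideanSpace ℂ (Fin d)) :
      Fannes.diagForm hρ.1.eigenvectorBasis hρ.1.eigenvalues x -
        Fannes.diagForm hσ.1.eigenvectorBasis hσ.1.eigenvalues x =
      Fannes.diagForm (hρ.1.sub hσ.1).eigenvectorBasis (hρ.1.sub hσ.1).eigenvalues x := by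
    simp only [Fannes.diagForm_eq_re_inner_toEuclideanLin, map_sub, LinearMap.sub_apply,
      inner_sub_right, Complex.sub_re]
  have hρ1 := Fannes.sum_eigenvalues_eq_one hρ.1 hρtr
  have hσ1 := Fannes.sum_eigenvalues_eq_one hσ.1 hσtr
  have h1 := Fannes.entropy_sub_le _ _ _ hρ.eigenvalues_nonneg hσ.eigenvalues_nonneg hρ1 hσ1 hdiff
  have h2 := Fannes.entropy_sub_le _ _ (hρ.1.sub hσ.1).eigenvectorBasis
    (m := -(hρ.1.sub hσ.1).eigenvalues) hσ.eigenvalues_nonneg hρ.eigenvalues_nonneg hσ1 hρ1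
    fun x => by rw [Fannes.diagForm_neg, ← hdiff, neg_sub]
  simp only [Pi.neg_apply, abs_neg] at h2
  rw [vnEntropy, vnEntropy, dif_pos hρ.1, dif_pos hσ.1, abs_sub_le_iff]
  exact ⟨h2, h1⟩
end

section
/- Let m, n ≥ 1 and let ρ be a density matrix on ℂ^m ⊗ ℂ^n, i.e., a positive semidefinite matrix of trace 1 indexed by (Fin m × Fin n). Define the partial traces ρ_A : Matrix (Fin m) (Fin m) ℂ by (ρ_A)_{a,a'} := ∑_b ρ_{(a,b),(a',b)} and ρ_B : Matrix (Fin n) (Fin n) ℂ by (ρ_B)_{b,b'} := ∑_a ρ_{(a,b),(a,b')}. Then ρ_A and ρ_B are density matrices and the von Neumann entropy is subadditive: S(ρ) ≤ S(ρ_A) + S(ρ_B). -/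
open scoped ComplexOrder

/-- The partial trace over the second tensor factor: `(ρ_A)_{a,a'} = ∑_b ρ_{(a,b),(a',b)}`. -/
noncomputable def partialTraceB {m n : ℕ} (ρ : Matrix (Fin m × Fin n) (Fin m × Fin n) ℂ) :
    Matrix (Fin m) (Fin m) ℂ :=
  Matrix.of fun a a' => ∑ b, ρ (a, b) (a', b)

/-- The partial trace over the first tensor factor: `(ρ_B)_{b,b'} = ∑_a ρ_{(a,b),(a,b')}`. -/
noncomputable def partialTraceA {m n : ℕ} (ρ : Matrix (Fin m × Fin n) (Fin m × Fin n) ℂ) :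
    Matrix (Fin n) (Fin n) ℂ :=
  Matrix.of fun b b' => ∑ a, ρ (a, b) (a, b')

open Matrix Kronecker

/-- Summing a matrix against `X ⊗ 1` only sees its partial trace over the second factor. -/
theorem trace_mul_kronecker_one {m n : ℕ} (ρ : Matrix (Fin m × Fin n) (Fin m × Fin n) ℂ)
    (X : Matrix (Fin m) (Fin m) ℂ) :
    (ρ * (X ⊗ₖ (1 : Matrix (Fin n) (Fin n) ℂ))).trace = (partialTraceB ρ * X).trace := by
  simp only [trace, diag_apply, mul_apply, Fintype.sum_prod_type, kroneckerMap_apply, one_apply,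
    partialTraceB, of_apply, Finset.sum_mul, mul_ite, mul_one, mul_zero, Finset.sum_ite_eq',
    Finset.mem_univ, if_true]
  exact Finset.sum_congr rfl fun a _ => Finset.sum_comm

/-- Summing a matrix against `1 ⊗ Y` only sees its partial trace over the first factor. -/
theorem trace_mul_one_kronecker {m n : ℕ} (ρ : Matrix (Fin m × Fin n) (Fin m × Fin n) ℂ)
    (Y : Matrix (Fin n) (Fin n) ℂ) :
    (ρ * ((1 : Matrix (Fin m) (Fin m) ℂ) ⊗ₖ Y)).trace = (partialTraceA ρ * Y).trace := by
  simp only [trace, diag_apply, mul_apply, Fintype.sum_prod_type_right, kroneckerMap_apply,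
    one_apply, partialTraceA, of_apply, Finset.sum_mul, ite_mul, one_mul, zero_mul, mul_ite,
    mul_zero, Finset.sum_ite_eq', Finset.mem_univ, if_true]
  exact Finset.sum_congr rfl fun a _ => Finset.sum_comm

theorem partialTraceB_conj_kronecker {m n : ℕ} (ρ : Matrix (Fin m × Fin n) (Fin m × Fin n) ℂ)
    (A : Matrix (Fin m) (Fin m) ℂ) {B : Matrix (Fin n) (Fin n) ℂ} (hB : B * Bᴴ = 1) :
    partialTraceB ((A ⊗ₖ B)ᴴ * ρ * (A ⊗ₖ B)) = Aᴴ * partialTraceB ρ * A := by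
  refine ext_iff_trace_mul_right.mpr fun X => ?_
  rw [← trace_mul_kronecker_one, mul_assoc, mul_assoc, trace_mul_comm, mul_assoc, mul_assoc,
    conjTranspose_kronecker, ← mul_kronecker_mul, one_mul, ← mul_kronecker_mul, hB,
    trace_mul_kronecker_one, mul_assoc Aᴴ, mul_assoc Aᴴ, trace_mul_comm Aᴴ]
  simp only [mul_assoc]

theorem partialTraceA_conj_kronecker {m n : ℕ} (ρ : Matrix (Fin m × Fin n) (Fin m × Fin n) ℂ)
    {A : Matrix (Fin m) (Fin m) ℂ} (B : Matrix (Fin n) (Fin n) ℂ) (hA : A * Aᴴ = 1) :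
    partialTraceA ((A ⊗ₖ B)ᴴ * ρ * (A ⊗ₖ B)) = Bᴴ * partialTraceA ρ * B := by
  refine ext_iff_trace_mul_right.mpr fun X => ?_
  rw [← trace_mul_one_kronecker, mul_assoc, mul_assoc, trace_mul_comm, mul_assoc, mul_assoc,
    conjTranspose_kronecker, ← mul_kronecker_mul, one_mul, ← mul_kronecker_mul, hA,
    trace_mul_one_kronecker, mul_assoc Bᴴ, mul_assoc Bᴴ, trace_mul_comm Bᴴ]
  simp only [mul_assoc]

theorem trace_partialTraceB {m n : ℕ} (ρ : Matrix (Fin m × Fin n) (Fin m × Fin n) ℂ) :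
    (partialTraceB ρ).trace = ρ.trace := by
  simpa using (trace_mul_kronecker_one ρ 1).symm

theorem trace_partialTraceA {m n : ℕ} (ρ : Matrix (Fin m × Fin n) (Fin m × Fin n) ℂ) :
    (partialTraceA ρ).trace = ρ.trace := by
  simpa using (trace_mul_one_kronecker ρ 1).symm

theorem posSemidef_partialTraceB {m n : ℕ}
    {ρ : Matrix (Fin m × Fin n) (Fin m × Fin n) ℂ} (hρ : ρ.PosSemidef) :
    (partialTraceB ρ).PosSemidef := by
  have h : partialTraceB ρ = ∑ b, ρ.submatrix (·, b) (·, b) := by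
    ext a a'
    simp [partialTraceB, Matrix.sum_apply]
  rw [h]
  exact posSemidef_sum _ fun b _ => hρ.submatrix _

theorem posSemidef_partialTraceA {m n : ℕ}
    {ρ : Matrix (Fin m × Fin n) (Fin m × Fin n) ℂ} (hρ : ρ.PosSemidef) :
    (partialTraceA ρ).PosSemidef := by
  have h : partialTraceA ρ = ∑ a, ρ.submatrix (a, ·) (a, ·) := by
    ext b b'
    simp [partialTraceA, Matrix.sum_apply]
  rw [h]
  exact posSemidef_sum _ fun a _ => hρ.submatrix _

theorem vnEntropy_eq_sum_negMulLog {ι : Type*} [Fintype ι] [DecidableEq ι] {ρ : Matrix ι ι ℂ}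
    (h : ρ.IsHermitian) : vnEntropy ρ = ∑ i, Real.negMulLog (h.eigenvalues i) := by
  simp [vnEntropy, h, Real.negMulLog]

theorem conj_eigenvectorUnitary {ι : Type*} [Fintype ι] [DecidableEq ι] {ρ : Matrix ι ι ℂ}
    (h : ρ.IsHermitian) :
    (h.eigenvectorUnitary : Matrix ι ι ℂ)ᴴ * ρ * (h.eigenvectorUnitary : Matrix ι ι ℂ) =
      diagonal (fun i => (h.eigenvalues i : ℂ)) := by
  simpa [Unitary.conjStarAlgAut_star_apply, star_eq_conjTranspose, Function.comp_def] using
    h.conjStarAlgAut_star_eigenvectorUnitary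

theorem sum_normSq_row_of_mul_conjTranspose {ι : Type*} [Fintype ι] [DecidableEq ι]
    {W : Matrix ι ι ℂ} (hW : W * Wᴴ = 1) (x : ι) : ∑ k, Complex.normSq (W x k) = 1 := by
  have h := congr_fun (congr_fun hW x) x
  simp only [mul_apply, conjTranspose_apply, Complex.star_def, Complex.mul_conj, one_apply_eq] at h
  exact_mod_cast h

theorem sum_normSq_col_of_conjTranspose_mul {ι : Type*} [Fintype ι] [DecidableEq ι]
    {W : Matrix ι ι ℂ} (hW : Wᴴ * W = 1) (k : ι) : ∑ x, Complex.normSq (W x k) = 1 := by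
  simpa using sum_normSq_row_of_mul_conjTranspose (W := Wᴴ) (by simpa using hW) k

/-- The entropy of a positive semidefinite matrix is at most the Shannon entropy of its diagonal
in any orthonormal basis. -/
theorem vnEntropy_le_sum_negMulLog_diag {ι : Type*} [Fintype ι] [DecidableEq ι]
    {ρ : Matrix ι ι ℂ} (hρ : ρ.PosSemidef) {U : Matrix ι ι ℂ} (hU : U ∈ unitaryGroup ι ℂ) :
    vnEntropy ρ ≤ ∑ x, Real.negMulLog ((Uᴴ * ρ * U) x x).re := by
  have hh := hρ.isHermitian
  set V := hh.eigenvectorUnitary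
  set W : Matrix ι ι ℂ := Uᴴ * (V : Matrix ι ι ℂ) with hWdef
  have hW : W ∈ unitaryGroup ι ℂ := mul_mem (Unitary.star_mem hU) V.2
  have hρW : Uᴴ * ρ * U = W * diagonal (fun i => (hh.eigenvalues i : ℂ)) * Wᴴ := by
    have hV : (V : Matrix ι ι ℂ) * (V : Matrix ι ι ℂ)ᴴ = 1 := mem_unitaryGroup_iff.mp V.2
    calc Uᴴ * ρ * U = Uᴴ * (V * (V : Matrix ι ι ℂ)ᴴ) * ρ * (V * (V : Matrix ι ι ℂ)ᴴ) * U := by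
          rw [hV, mul_one, mul_one]
      _ = _ := by
          rw [← conj_eigenvectorUnitary hh, hWdef]
          simp only [conjTranspose_mul, conjTranspose_conjTranspose, mul_assoc, V]
  have hdiag (x : ι) :
      ((Uᴴ * ρ * U) x x).re = ∑ k, Complex.normSq (W x k) • hh.eigenvalues k := by
    rw [hρW, mul_apply, Complex.re_sum]
    refine Finset.sum_congr rfl fun k _ => ?_
    rw [mul_diagonal, conjTranspose_apply, mul_right_comm, Complex.star_def, Complex.mul_conj,
      ← Complex.ofReal_mul, Complex.ofReal_re, smul_eq_mul]
  calc vnEntropy ρ = ∑ k, (∑ x, Complex.normSq (W x k)) * Real.negMulLog (hh.eigenvalues k) := by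
        simp_rw [sum_normSq_col_of_conjTranspose_mul (mem_unitaryGroup_iff'.mp hW), one_mul]
        exact vnEntropy_eq_sum_negMulLog hh
    _ = ∑ x, ∑ k, Complex.normSq (W x k) • Real.negMulLog (hh.eigenvalues k) := by
        simp_rw [Finset.sum_mul, smul_eq_mul]
        exact Finset.sum_comm
    _ ≤ _ := Finset.sum_le_sum fun x _ => by
        rw [hdiag]
        exact Real.concaveOn_negMulLog.le_map_sum (fun k _ => Complex.normSq_nonneg _)
          (sum_normSq_row_of_mul_conjTranspose (mem_unitaryGroup_iff.mp hW) x)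
          fun k _ => hρ.eigenvalues_nonneg k

/-- Subadditivity of the Shannon entropy. -/
theorem sum_negMulLog_le_add_marginals {α β : Type*} [Fintype α] [Fintype β] (p : α × β → ℝ)
    (hp : ∀ x, 0 ≤ p x) (hp1 : ∑ x, p x = 1) :
    ∑ x, Real.negMulLog (p x) ≤
      ∑ a, Real.negMulLog (∑ b, p (a, b)) + ∑ b, Real.negMulLog (∑ a, p (a, b)) := by
  set q : α → ℝ := fun a => ∑ b, p (a, b) with hq
  set r : β → ℝ := fun b => ∑ a, p (a, b) with hr
  have hq0 (a : α) : 0 ≤ q a := Finset.sum_nonneg fun b _ => hp _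
  have hr0 (b : β) : 0 ≤ r b := Finset.sum_nonneg fun a _ => hp _
  have key (x : α × β) : Real.negMulLog (p x) ≤
      -(p x * Real.log (q x.1)) - p x * Real.log (r x.2) + (q x.1 * r x.2 - p x) := by
    rcases (hp x).eq_or_lt with h | h
    · simpa [← h] using mul_nonneg (hq0 x.1) (hr0 x.2)
    · have hqx : 0 < q x.1 := h.trans_le <|
        Finset.single_le_sum (f := fun b => p (x.1, b)) (fun b _ => hp _) (Finset.mem_univ x.2)
      have hrx : 0 < r x.2 := h.trans_le <|
        Finset.single_le_sum (f := fun a => p (a, x.2)) (fun a _ => hp _) (Finset.mem_univ x.1)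
      have hlog := mul_le_mul_of_nonneg_left
        (Real.log_le_sub_one_of_pos (div_pos (mul_pos hqx hrx) h)) h.le
      rw [Real.log_div (mul_pos hqx hrx).ne' h.ne', Real.log_mul hqx.ne' hrx.ne', mul_sub, mul_sub,
        mul_div_cancel₀ _ h.ne'] at hlog
      rw [Real.negMulLog]
      linarith
  have hq1 : ∑ a, q a = 1 := by rw [← hp1, Fintype.sum_prod_type]
  have hr1 : ∑ b, r b = 1 := by rw [← hp1, Fintype.sum_prod_type_right]
  have hprod : ∑ x : α × β, q x.1 * r x.2 = 1 := by
    rw [Fintype.sum_prod_type, ← Fintype.sum_mul_sum, hq1, hr1, one_mul]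
  have hqlog : ∑ x : α × β, p x * Real.log (q x.1) = ∑ a, q a * Real.log (q a) := by
    simp_rw [Fintype.sum_prod_type, ← Finset.sum_mul, hq]
  have hrlog : ∑ x : α × β, p x * Real.log (r x.2) = ∑ b, r b * Real.log (r b) := by
    simp_rw [Fintype.sum_prod_type_right, ← Finset.sum_mul, hr]
  refine (Finset.sum_le_sum fun x _ => key x).trans_eq ?_
  simp only [Finset.sum_add_distrib, Finset.sum_sub_distrib, Finset.sum_neg_distrib, hprod, hqlog,
    hrlog, hp1, Real.negMulLog, neg_mul]
  ring

/-- For a density matrix `ρ` on `ℂ^m ⊗ ℂ^n`, the partial traces `ρ_A`, `ρ_B` are density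
matrices and the von Neumann entropy is subadditive: `S(ρ) ≤ S(ρ_A) + S(ρ_B)`. -/
theorem entropy_subadditive (m n : ℕ) (hm : 1 ≤ m) (hn : 1 ≤ n)
    (ρ : Matrix (Fin m × Fin n) (Fin m × Fin n) ℂ) (hρ : ρ.PosSemidef) (hρtr : ρ.trace = 1) :
    (partialTraceB ρ).PosSemidef ∧ (partialTraceB ρ).trace = 1 ∧
    (partialTraceA ρ).PosSemidef ∧ (partialTraceA ρ).trace = 1 ∧
    vnEntropy ρ ≤ vnEntropy (partialTraceB ρ) + vnEntropy (partialTraceA ρ) := by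
  have hA := posSemidef_partialTraceB hρ
  have hB := posSemidef_partialTraceA hρ
  refine ⟨hA, (trace_partialTraceB ρ).trans hρtr, hB, (trace_partialTraceA ρ).trans hρtr, ?_⟩
  set A := hA.isHermitian.eigenvectorUnitary
  set B := hB.isHermitian.eigenvectorUnitary
  set U := (A : Matrix (Fin m) (Fin m) ℂ) ⊗ₖ (B : Matrix (Fin n) (Fin n) ℂ) with hUdef
  have hU : U ∈ unitaryGroup (Fin m × Fin n) ℂ := kronecker_mem_unitary A.2 B.2
  set σ := Uᴴ * ρ * U with hσ
  have hσpos : σ.PosSemidef := hρ.conjTranspose_mul_mul_same U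
  have hσA : partialTraceB σ = diagonal (fun i => (hA.isHermitian.eigenvalues i : ℂ)) := by
    rw [hσ, hUdef, partialTraceB_conj_kronecker _ _ (mem_unitaryGroup_iff.mp B.2),
      conj_eigenvectorUnitary]
  have hσB : partialTraceA σ = diagonal (fun i => (hB.isHermitian.eigenvalues i : ℂ)) := by
    rw [hσ, hUdef, partialTraceA_conj_kronecker _ _ (mem_unitaryGroup_iff.mp A.2),
      conj_eigenvectorUnitary]
  have hσtr : σ.trace = 1 := by
    have hUU : U * Uᴴ = 1 := mem_unitaryGroup_iff.mp hU
    rw [hσ, trace_mul_comm, ← mul_assoc, hUU, one_mul, hρtr]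
  have hmargA (a : Fin m) : ∑ b, (σ (a, b) (a, b)).re = hA.isHermitian.eigenvalues a := by
    simpa [partialTraceB] using congr_arg Complex.re (congr_fun (congr_fun hσA a) a)
  have hmargB (b : Fin n) : ∑ a, (σ (a, b) (a, b)).re = hB.isHermitian.eigenvalues b := by
    simpa [partialTraceA] using congr_arg Complex.re (congr_fun (congr_fun hσB b) b)
  have hsum : ∑ x, (σ x x).re = 1 := by
    simpa [trace] using congr_arg Complex.re hσtr
  have hsub := sum_negMulLog_le_add_marginals (fun x => (σ x x).re)
    (fun x => (Complex.le_def.mp hσpos.diag_nonneg).1) hsum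
  simp only [hmargA, hmargB] at hsub
  rw [vnEntropy_eq_sum_negMulLog hA.isHermitian, vnEntropy_eq_sum_negMulLog hB.isHermitian]
  exact (vnEntropy_le_sum_negMulLog_diag hρ hU).trans hsub
end
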